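/- arXiv:1101.3978 — 3 statements merged into one kernel-verified Lean document; each statement's English description precedes it below -/
import Mathlib

section
/- Let $N \ge 2$ and let $\beta, \gamma, \nu \in \mathbb{R}$ and $1 < p \le q < \infty$ satisfy: $\gamma - 1 \le \beta \le \gamma$, $\frac{1}{p} - \frac{1}{q} = \frac{1 - \gamma + \beta}{N}$, $N + p(\gamma-1) \ne 0$, $p < N$, and $q \le p^* := \frac{Np}{N-p}$. Then there exists a constant $C > 0$ such that for every $u \in C_c^\infty(\mathbb{R}^N)$, $\left(\int_{\mathbb{R}^N} (1+|x|)^{q\beta} |u(x)|^q \, dx\right)^{\frac{1}{q}} \le C \left(\int_{\mathbb{R}^N} (1+|x|)^{\gamma p} |\nabla u(x)|^p \, dx\right)^{\frac{1}{p}} + C \left(\int_{\mathbb{R}^N} (1+|x|)^{\nu} |u(x)|^p \, dx\right)^{\frac{1}{p}}$. -/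
open MeasureTheory

namespace WSob

variable {N : ℕ}

noncomputable def wt (t : ℝ) (x : EuclideanSpace ℝ (Fin N)) : ℝ := (1 + ‖x‖ ^ 2) ^ (t / 2)

lemma base_pos (x : EuclideanSpace ℝ (Fin N)) : 0 < 1 + ‖x‖ ^ 2 := by positivity

lemma base_ge (x : EuclideanSpace ℝ (Fin N)) : 1 ≤ 1 + ‖x‖ ^ 2 := by nlinarith [sq_nonneg ‖x‖]

lemma wt_pos (t : ℝ) (x : EuclideanSpace ℝ (Fin N)) : 0 < wt t x :=
  Real.rpow_pos_of_pos (base_pos x) _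

lemma wt_mul (s t : ℝ) (x : EuclideanSpace ℝ (Fin N)) : wt s x * wt t x = wt (s + t) x := by
  unfold wt
  rw [← Real.rpow_add (base_pos x)]
  congr 1; ring

lemma wt_rpow (s r : ℝ) (x : EuclideanSpace ℝ (Fin N)) : wt s x ^ r = wt (s * r) x := by
  unfold wt
  rw [← Real.rpow_mul (base_pos x).le]
  congr 1; ring

lemma wt_two (x : EuclideanSpace ℝ (Fin N)) : wt 2 x = 1 + ‖x‖ ^ 2 := by
  unfold wt
  norm_num

lemma norm_le_wt (x : EuclideanSpace ℝ (Fin N)) : ‖x‖ ≤ wt 1 x := by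
  unfold wt
  rw [← Real.sqrt_eq_rpow]
  apply Real.le_sqrt_of_sq_le
  linarith

lemma wt_contDiff (t : ℝ) : ContDiff ℝ 1 (wt t : EuclideanSpace ℝ (Fin N) → ℝ) := by
  unfold wt
  apply ContDiff.rpow_const_of_ne
  · exact contDiff_const.add (contDiff_norm_sq ℝ)
  · intro x; exact (base_pos x).ne'

lemma wt_cont (t : ℝ) : Continuous (wt t : EuclideanSpace ℝ (Fin N) → ℝ) :=
  (wt_contDiff t).continuous

lemma wt_hasFDerivAt (t : ℝ) (x : EuclideanSpace ℝ (Fin N)) :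
    HasFDerivAt (wt t) ((t * wt (t - 2) x) • innerSL ℝ x) x := by
  have h := ((hasStrictFDerivAt_norm_sq x).hasFDerivAt.const_add 1).rpow_const (p := t / 2)
    (Or.inl (base_pos x).ne')
  refine h.congr_fderiv ?_
  ext v
  simp [wt]
  rw [show t / 2 - 1 = (t - 2) / 2 by ring]
  ring

lemma wt_fderiv_norm (t : ℝ) (x : EuclideanSpace ℝ (Fin N)) :
    ‖fderiv ℝ (wt t) x‖ ≤ |t| * wt (t - 1) x := by
  rw [(wt_hasFDerivAt t x).fderiv, norm_smul, innerSL_apply_norm, norm_mul, Real.norm_eq_abs,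
    Real.norm_eq_abs, abs_of_pos (wt_pos _ x), mul_assoc]
  gcongr
  calc wt (t - 2) x * ‖x‖ ≤ wt (t - 2) x * wt 1 x := by
        gcongr
        · exact (wt_pos _ x).le
        · exact norm_le_wt x
    _ = _ := by rw [wt_mul]; congr 1; ring

/-- comparison of weights -/
lemma wt_le (t : ℝ) (x : EuclideanSpace ℝ (Fin N)) : wt t x ≤ 2 ^ |t| * (1 + ‖x‖) ^ t := by
  have h0 := norm_nonneg x
  have h1 : wt 1 x ≤ 1 + ‖x‖ := by
    unfold wt
    rw [← Real.sqrt_eq_rpow]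
    apply Real.sqrt_le_iff.2 ⟨by positivity, by nlinarith⟩
  have h2 : 1 + ‖x‖ ≤ 2 * wt 1 x := by
    have : 1 ≤ wt 1 x := Real.one_le_rpow (base_ge x) (by norm_num)
    linarith [norm_le_wt x]
  have hw : wt t x = wt 1 x ^ t := by rw [wt_rpow, one_mul]
  rw [hw]
  rcases le_total 0 t with ht | ht
  · calc wt 1 x ^ t ≤ (1 + ‖x‖) ^ t := Real.rpow_le_rpow (wt_pos _ x).le h1 ht
      _ ≤ _ := le_mul_of_one_le_left (by positivity) (Real.one_le_rpow (by norm_num) (abs_nonneg _))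
  · have : (2 * wt 1 x) ^ t ≤ (1 + ‖x‖) ^ t := Real.rpow_le_rpow_of_nonpos (by positivity) h2 ht
    rw [Real.mul_rpow (by norm_num) (wt_pos _ x).le] at this
    calc wt 1 x ^ t = 2 ^ |t| * (2 ^ t * wt 1 x ^ t) := by
          rw [← mul_assoc, ← Real.rpow_add (by norm_num), abs_of_nonpos ht]; simp
      _ ≤ _ := by gcongr

lemma le_wt (t : ℝ) (x : EuclideanSpace ℝ (Fin N)) : (1 + ‖x‖) ^ t ≤ 2 ^ |t| * wt t x := by
  have h := wt_le (-t) x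
  have h0 := norm_nonneg x
  have h1 : wt (-t) x * wt t x = 1 := by rw [wt_mul]; simp [wt]
  have h2 : (1 + ‖x‖) ^ (-t) * (1 + ‖x‖) ^ t = 1 := by
    rw [← Real.rpow_add (by positivity)]; simp
  rw [abs_neg] at h
  have h3 : 0 ≤ wt t x * (1 + ‖x‖) ^ t := mul_nonneg (wt_pos _ x).le (by positivity)
  calc (1 + ‖x‖) ^ t = wt (-t) x * (wt t x * (1 + ‖x‖) ^ t) := by rw [← mul_assoc, h1, one_mul]
    _ ≤ (2 ^ |t| * (1 + ‖x‖) ^ (-t)) * (wt t x * (1 + ‖x‖) ^ t) := by gcongr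
    _ = 2 ^ |t| * wt t x * ((1 + ‖x‖) ^ (-t) * (1 + ‖x‖) ^ t) := by ring
    _ = _ := by rw [h2, mul_one]

/-- lower order weights are absorbed -/
lemma wt_absorb (s ν δ : ℝ) (hδ : 0 < δ) : ∃ K : ℝ, 0 ≤ K ∧ ∀ x : EuclideanSpace ℝ (Fin N),
    |s| * wt (s - 2) x ≤ δ * wt s x + K * wt ν x := by
  refine ⟨|s| * (|s| / δ) ^ (|s - 2 - ν| / 2), by positivity, fun x => ?_⟩
  have hs : wt s x = wt (s - 2) x * (1 + ‖x‖ ^ 2) := by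
    rw [← wt_two, wt_mul]; congr 1; ring
  have hp := wt_pos (s - 2) x
  have hpn := wt_pos ν x
  have hps := wt_pos s x
  by_cases hc : |s| ≤ δ * (1 + ‖x‖ ^ 2)
  · have : |s| * wt (s - 2) x ≤ δ * wt s x := by
      rw [hs]
      calc _ ≤ δ * (1 + ‖x‖ ^ 2) * wt (s - 2) x := by gcongr
        _ = _ := by ring
    have h2 : 0 ≤ |s| * (|s| / δ) ^ (|s - 2 - ν| / 2) * wt ν x := by positivity
    linarith
  · push Not at hc
    have hM : 1 + ‖x‖ ^ 2 ≤ |s| / δ := by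
      rw [le_div_iff₀ hδ]; linarith
    have h3 : wt (s - 2) x = wt (s - 2 - ν) x * wt ν x := by rw [wt_mul]; congr 1; ring
    have h4 : wt (s - 2 - ν) x ≤ (|s| / δ) ^ (|s - 2 - ν| / 2) := by
      unfold wt
      calc _ ≤ (1 + ‖x‖ ^ 2) ^ (|s - 2 - ν| / 2) := by
            apply Real.rpow_le_rpow_of_exponent_le (base_ge x)
            gcongr; exact le_abs_self _
        _ ≤ _ := by gcongr
    rw [h3]
    have h5 : |s| * (wt (s - 2 - ν) x * wt ν x) ≤ |s| * (|s| / δ) ^ (|s - 2 - ν| / 2) * wt ν x := by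
      rw [mul_assoc]; gcongr
    have : 0 ≤ δ * wt s x := by positivity
    linarith

lemma young (p δ : ℝ) (hp : 1 < p) (hδ : 0 < δ) : ∃ K : ℝ, 0 ≤ K ∧ ∀ a b : ℝ, 0 ≤ a → 0 ≤ b →
    a ^ (p - 1) * b ≤ δ * a ^ p + K * b ^ p := by
  refine ⟨δ⁻¹ ^ (p - 1), by positivity, fun a b ha hb => ?_⟩
  have key : ∀ c : ℝ, 0 ≤ c → c ^ (p - 1) * c = c ^ p := by
    intro c hc
    rw [← Real.rpow_add_one' hc (by linarith)]; congr 1; ring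
  by_cases h : b ≤ δ * a
  · have h1 : a ^ (p - 1) * b ≤ δ * a ^ p := by
      rw [← key a ha]
      calc _ ≤ a ^ (p - 1) * (δ * a) := by gcongr
        _ = _ := by ring
    have : 0 ≤ δ⁻¹ ^ (p - 1) * b ^ p := by positivity
    linarith
  · push Not at h
    have h1 : a ≤ δ⁻¹ * b := by
      rw [inv_mul_eq_div, le_div_iff₀ hδ]; linarith
    have h2 : a ^ (p - 1) ≤ δ⁻¹ ^ (p - 1) * b ^ (p - 1) := by
      rw [← Real.mul_rpow (by positivity) hb]
      exact Real.rpow_le_rpow ha h1 (by linarith)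
    have h3 : a ^ (p - 1) * b ≤ δ⁻¹ ^ (p - 1) * b ^ p := by
      rw [← key b hb, ← mul_assoc]; gcongr
    have : 0 ≤ δ * a ^ p := by positivity
    linarith

/-- the divergence identity -/
lemma div_identity (s : ℝ) (φ : EuclideanSpace ℝ (Fin N) → ℝ) (hφ : ContDiff ℝ 1 φ)
    (hc : HasCompactSupport φ) :
    ((N : ℝ) + s) * ∫ x, wt s x * φ x
      = s * (∫ x, wt (s - 2) x * φ x) - ∫ x, wt s x * fderiv ℝ φ x x := by
  have hφ' : Continuous (fderiv ℝ φ) := hφ.continuous_fderiv one_ne_zero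
  have hcs' := hc.fderiv (𝕜 := ℝ)
  have hd : ∀ x, DifferentiableAt ℝ φ x := fun x => (hφ.differentiable one_ne_zero) x
  let e : Fin N → EuclideanSpace ℝ (Fin N) := fun i => EuclideanSpace.single i 1
  have hF : ∀ i : Fin N, ∀ x, HasFDerivAt (fun x : EuclideanSpace ℝ (Fin N) => x i * wt s x)
      (x i • ((s * wt (s - 2) x) • innerSL ℝ x) + wt s x • (EuclideanSpace.proj i)) x := by
    intro i x
    exact ((EuclideanSpace.proj (𝕜 := ℝ) i).hasFDerivAt (x := x)).mul (wt_hasFDerivAt s x)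
  have hFv : ∀ i : Fin N, ∀ x, fderiv ℝ (fun x : EuclideanSpace ℝ (Fin N) => x i * wt s x) x (e i)
      = wt s x + s * wt (s - 2) x * x i ^ 2 := by
    intro i x
    rw [(hF i x).fderiv]
    simp [e, EuclideanSpace.inner_single_right]
    ring
  have c1 : ∀ t : ℝ, Continuous (wt t : EuclideanSpace ℝ (Fin N) → ℝ) := wt_cont
  have ci : ∀ i : Fin N, Continuous (fun x : EuclideanSpace ℝ (Fin N) => x i) :=
    fun i => (EuclideanSpace.proj (𝕜 := ℝ) i).continuous
  have cφ := hφ.continuous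
  have i1 : ∀ i : Fin N, Integrable (fun x => (wt s x + s * wt (s - 2) x * x i ^ 2) * φ x) := by
    intro i
    refine Continuous.integrable_of_hasCompactSupport ?_ (hc.mul_left)
    exact (((c1 s).add ((continuous_const.mul (c1 _)).mul ((ci i).pow 2))).mul cφ)
  have i2 : ∀ i : Fin N, Integrable (fun x => (x i * wt s x) * fderiv ℝ φ x (e i)) := by
    intro i
    refine Continuous.integrable_of_hasCompactSupport ?_ ?_
    · exact ((ci i).mul (c1 s)).mul (hφ'.clm_apply continuous_const)
    · exact (hc.fderiv_apply (𝕜 := ℝ) (e i)).mul_left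
  have i3 : ∀ i : Fin N, Integrable (fun x => (x i * wt s x) * φ x) := by
    intro i
    refine Continuous.integrable_of_hasCompactSupport ?_ (hc.mul_left)
    exact ((ci i).mul (c1 s)).mul cφ
  have ibp : ∀ i : Fin N, ∫ x, (x i * wt s x) * fderiv ℝ φ x (e i)
      = - ∫ x, (wt s x + s * wt (s - 2) x * x i ^ 2) * φ x := by
    intro i
    have := integral_mul_fderiv_eq_neg_fderiv_mul_of_integrable (μ := volume)
      (f := fun x : EuclideanSpace ℝ (Fin N) => x i * wt s x) (g := φ) (v := e i)
      (by simpa only [hFv] using i1 i) (i2 i) (i3 i)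
      (fun x _ => (hF i x).differentiableAt) (fun x _ => hd x)
    simpa only [hFv] using this
  have hsum := Finset.sum_congr (rfl : (Finset.univ : Finset (Fin N)) = Finset.univ)
    (fun i _ => ibp i)
  rw [Finset.sum_neg_distrib, ← integral_finsetSum _ (fun i _ => i2 i),
    ← integral_finsetSum _ (fun i _ => i1 i)] at hsum
  have e1 : ∀ x : EuclideanSpace ℝ (Fin N), ∑ i, (x i * wt s x) * fderiv ℝ φ x (e i)
      = wt s x * fderiv ℝ φ x x := by
    intro x
    have hx : x = ∑ i, x i • e i := by
      ext j
      simp [e, Finset.sum_apply, Pi.single_apply]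
    conv_rhs => rw [show fderiv ℝ φ x x = fderiv ℝ φ x (∑ i, x i • e i) by rw [← hx]]
    rw [map_sum, Finset.mul_sum]
    refine Finset.sum_congr rfl fun i _ => ?_
    rw [map_smul, smul_eq_mul]; ring
  have e2 : ∀ x : EuclideanSpace ℝ (Fin N), ∑ i, (wt s x + s * wt (s - 2) x * x i ^ 2) * φ x
      = ((N : ℝ) + s) * (wt s x * φ x) - s * (wt (s - 2) x * φ x) := by
    intro x
    rw [← Finset.sum_mul, Finset.sum_add_distrib, ← Finset.mul_sum,
      ← EuclideanSpace.real_norm_sq_eq]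
    have hs : wt s x = wt (s - 2) x * (1 + ‖x‖ ^ 2) := by
      rw [← wt_two, wt_mul]; congr 1; ring
    simp only [Finset.sum_const, Finset.card_univ, Fintype.card_fin, nsmul_eq_mul]
    rw [hs]; ring
  simp only [e1, e2] at hsum
  rw [integral_sub, integral_const_mul, integral_const_mul] at hsum
  · linarith
  · exact (((c1 s).mul cφ).integrable_of_hasCompactSupport hc.mul_left).const_mul _
  · exact (((c1 _).mul cφ).integrable_of_hasCompactSupport hc.mul_left).const_mul _

section
variable {u : EuclideanSpace ℝ (Fin N) → ℝ} 

lemma cs_rpow {f : EuclideanSpace ℝ (Fin N) → ℝ} (hc : HasCompactSupport f) {r : ℝ} (hr : 0 < r) :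
    HasCompactSupport (fun x => f x ^ r) :=
  hc.comp_left (g := fun y : ℝ => y ^ r) (Real.zero_rpow hr.ne')

lemma int_u (hu : ContDiff ℝ 1 u) (hc : HasCompactSupport u) (t r : ℝ) (hr : 0 < r) :
    Integrable (fun x => wt t x * |u x| ^ r) := by
  refine Continuous.integrable_of_hasCompactSupport ?_ ?_
  · exact (wt_cont t).mul (hu.continuous.abs.rpow_const fun _ => Or.inr hr.le)
  · exact (cs_rpow hc.norm hr).mul_left

lemma int_du (hu : ContDiff ℝ 1 u) (hc : HasCompactSupport u) (t r : ℝ) (hr : 0 < r) :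
    Integrable (fun x => wt t x * ‖fderiv ℝ u x‖ ^ r) := by
  refine Continuous.integrable_of_hasCompactSupport ?_ ?_
  · exact (wt_cont t).mul ((hu.continuous_fderiv one_ne_zero).norm.rpow_const fun _ => Or.inr hr.le)
  · exact (cs_rpow (hc.fderiv (𝕜 := ℝ)).norm hr).mul_left
end

lemma hardy (γ ν p : ℝ) (hp : 1 < p) (hne : (N : ℝ) + p * (γ - 1) ≠ 0) :
    ∃ C : ℝ, 0 ≤ C ∧ ∀ u : EuclideanSpace ℝ (Fin N) → ℝ, ContDiff ℝ 1 u → HasCompactSupport u →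
      ∫ x, wt (p * (γ - 1)) x * |u x| ^ p ≤
        C * ((∫ x, wt (γ * p) x * ‖fderiv ℝ u x‖ ^ p) + ∫ x, wt ν x * |u x| ^ p) := by
  set s := p * (γ - 1) with hs
  have hd : 0 < |(N : ℝ) + s| := abs_pos.2 hne
  set d := |(N : ℝ) + s| with hdd
  obtain ⟨K1, hK1, h1⟩ := wt_absorb (N := N) s ν (d / 4) (by positivity)
  obtain ⟨K2, hK2, h2⟩ := young p (d / 4 / p) hp (by positivity)
  refine ⟨2 / d * (K1 + p * K2), by positivity, fun u hu hc => ?_⟩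
  have hp0 : 0 < p := by linarith
  have hid := div_identity s (fun x => |u x| ^ p) (hu.norm_rpow hp) (cs_rpow hc.norm hp0)
  set A := ∫ x, wt s x * |u x| ^ p with hA
  set G := ∫ x, wt (γ * p) x * ‖fderiv ℝ u x‖ ^ p with hG
  set B := ∫ x, wt ν x * |u x| ^ p with hB
  have hG0 : 0 ≤ G := integral_nonneg fun x => mul_nonneg (wt_pos _ x).le (by positivity)
  have hB0 : 0 ≤ B := integral_nonneg fun x => mul_nonneg (wt_pos _ x).le (by positivity)
  have hI1 : |s * ∫ x, wt (s - 2) x * |u x| ^ p| ≤ d / 4 * A + K1 * B := by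
    rw [abs_mul, abs_of_nonneg (integral_nonneg fun x => mul_nonneg (wt_pos _ x).le (by positivity)),
      ← integral_const_mul, hA, hB, ← integral_const_mul, ← integral_const_mul, ← integral_add]
    · refine integral_mono ((int_u hu hc _ p hp0).const_mul _)
        (((int_u hu hc _ p hp0).const_mul _).add ((int_u hu hc _ p hp0).const_mul _)) fun x => ?_
      have := mul_le_mul_of_nonneg_right (h1 x) (by positivity : 0 ≤ |u x| ^ p)
      simp only
      linarith
    · exact (int_u hu hc _ p hp0).const_mul _
    · exact (int_u hu hc _ p hp0).const_mul _
  have hI2 : |∫ x, wt s x * fderiv ℝ (fun x => |u x| ^ p) x x| ≤ d / 4 * A + p * K2 * G := by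
    rw [hA, hG, ← integral_const_mul, ← integral_const_mul, ← integral_add]
    · rw [← Real.norm_eq_abs]
      refine norm_integral_le_of_norm_le (((int_u hu hc _ p hp0).const_mul _).add
        ((int_du hu hc _ p hp0).const_mul _)) (Filter.Eventually.of_forall fun x => ?_)
      have hw := wt_pos s x
      have hdn : ‖fderiv ℝ (fun x => |u x| ^ p) x‖ ≤ p * |u x| ^ (p - 1) * ‖fderiv ℝ u x‖ :=
        norm_fderiv_norm_rpow_le (hu.differentiable one_ne_zero) hp
      have hy := h2 (wt (s / p) x * |u x|) (wt (s / p + 1) x * ‖fderiv ℝ u x‖)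
        (mul_nonneg (wt_pos _ x).le (by positivity)) (mul_nonneg (wt_pos _ x).le (by positivity))
      rw [Real.mul_rpow (wt_pos _ x).le (by positivity), Real.mul_rpow (wt_pos _ x).le (by positivity),
        Real.mul_rpow (wt_pos _ x).le (by positivity), wt_rpow, wt_rpow, wt_rpow,
        show s / p * p = s by field_simp,
        show (s / p + 1) * p = γ * p by rw [hs]; field_simp; ring] at hy
      have hww : wt (s / p * (p - 1)) x * wt (s / p + 1) x = wt (s + 1) x := by
        rw [wt_mul]; congr 1; field_simp; ring
      calc ‖wt s x * fderiv ℝ (fun x => |u x| ^ p) x x‖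
          = wt s x * ‖fderiv ℝ (fun x => |u x| ^ p) x x‖ := by
            rw [norm_mul, Real.norm_eq_abs, abs_of_pos hw]
        _ ≤ wt s x * (p * |u x| ^ (p - 1) * ‖fderiv ℝ u x‖ * wt 1 x) := by
            gcongr
            refine (ContinuousLinearMap.le_opNorm _ _).trans ?_
            gcongr
            exact norm_le_wt x
        _ = p * ((wt s x * wt 1 x) * |u x| ^ (p - 1) * ‖fderiv ℝ u x‖) := by ring
        _ = p * (wt (s / p * (p - 1)) x * |u x| ^ (p - 1) * (wt (s / p + 1) x * ‖fderiv ℝ u x‖)) := by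
            rw [wt_mul, ← hww]; ring
        _ ≤ p * (d / 4 / p * (wt s x * |u x| ^ p) + K2 * (wt (γ * p) x * ‖fderiv ℝ u x‖ ^ p)) := by
            gcongr
        _ = _ := by field_simp
    · exact (int_u hu hc _ p hp0).const_mul _
    · exact (int_du hu hc _ p hp0).const_mul _
  have hA0 : 0 ≤ A := integral_nonneg fun x => mul_nonneg (wt_pos _ x).le (by positivity)
  have hfin : d * A ≤ (d / 4 * A + K1 * B) + (d / 4 * A + p * K2 * G) := by
    have : d * A = |((N : ℝ) + s) * A| := by rw [abs_mul, abs_of_nonneg hA0]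
    rw [this, hid]
    exact (abs_sub _ _).trans (add_le_add hI1 hI2)
  have h3 : d / 2 * A ≤ (K1 + p * K2) * (G + B) := by
    have : 0 ≤ K1 * G := by positivity
    have : 0 ≤ p * K2 * B := by positivity
    nlinarith
  calc A = 2 / d * (d / 2 * A) := by field_simp
    _ ≤ 2 / d * ((K1 + p * K2) * (G + B)) := by gcongr
    _ = _ := by ring

lemma sobolev (γ p r : ℝ) (hp : 1 < p) (hN : 0 < N) (hr : 0 < r) (hpr : r⁻¹ = p⁻¹ - (N : ℝ)⁻¹) :
    ∃ C : ℝ, 0 ≤ C ∧ ∀ u : EuclideanSpace ℝ (Fin N) → ℝ, ContDiff ℝ 1 u → HasCompactSupport u →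
      ∫ x, wt (γ * r) x * |u x| ^ r ≤
        (C * ((∫ x, wt (γ * p) x * ‖fderiv ℝ u x‖ ^ p) +
          ∫ x, wt (p * (γ - 1)) x * |u x| ^ p)) ^ (r / p) := by
  have hp0 : 0 < p := by linarith
  set P : NNReal := ⟨p, hp0.le⟩ with hP
  set R : NNReal := ⟨r, hr.le⟩ with hR
  set S : NNReal := SNormLESNormFDerivOfEqConst ℝ
    (volume : Measure (EuclideanSpace ℝ (Fin N))) P with hS
  refine ⟨(S : ℝ) ^ p * (2 ^ (p - 1) * (1 + |γ| ^ p)), by positivity, fun u hu hc => ?_⟩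
  set v : EuclideanSpace ℝ (Fin N) → ℝ := fun x => wt γ x * u x with hv
  have hvd : ContDiff ℝ 1 v := (wt_contDiff γ).mul hu
  have hvc : HasCompactSupport v := hc.mul_left
  have key := eLpNorm_le_eLpNorm_fderiv_of_eq (F := ℝ)
    (volume : Measure (EuclideanSpace ℝ (Fin N))) hvd hvc (p := P) (p' := R)
    (by rw [hP]; exact_mod_cast hp.le) (by simpa using hN) (by rw [finrank_euclideanSpace_fin]; exact hpr)
  have hvp : MemLp (fderiv ℝ v) P :=
    (hvd.continuous_fderiv one_ne_zero).memLp_of_hasCompactSupport (hvc.fderiv (𝕜 := ℝ))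
  have hvr : MemLp v R := hvd.continuous.memLp_of_hasCompactSupport hvc
  have hR0 : (R : ENNReal) ≠ 0 := by
    simp only [ne_eq, ENNReal.coe_eq_zero]; exact fun h => hr.ne' (congrArg NNReal.toReal h)
  have hP0 : (P : ENNReal) ≠ 0 := by
    simp only [ne_eq, ENNReal.coe_eq_zero]; exact fun h => hp0.ne' (congrArg NNReal.toReal h)
  rw [hvr.eLpNorm_eq_integral_rpow_norm hR0 ENNReal.coe_ne_top,
    hvp.eLpNorm_eq_integral_rpow_norm hP0 ENNReal.coe_ne_top, ← hS,
    ← ENNReal.ofReal_coe_nnreal (p := S), ← ENNReal.ofReal_mul (by positivity),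
    ENNReal.ofReal_le_ofReal_iff (by positivity)] at key
  simp only [ENNReal.coe_toReal] at key
  change (∫ a, ‖v a‖ ^ r) ^ r⁻¹ ≤ S * (∫ a, ‖fderiv ℝ v a‖ ^ p) ^ p⁻¹ at key
  have e1 : ∫ x, wt (γ * r) x * |u x| ^ r = ∫ x, ‖v x‖ ^ r := by
    congr 1; ext x
    rw [hv, norm_mul, Real.norm_eq_abs, Real.norm_eq_abs, abs_of_pos (wt_pos _ x),
      Real.mul_rpow (wt_pos _ x).le (abs_nonneg _), wt_rpow]
  have e2 : ∫ x, ‖fderiv ℝ v x‖ ^ p ≤ (2 ^ (p - 1) * (1 + |γ| ^ p)) *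
      ((∫ x, wt (γ * p) x * ‖fderiv ℝ u x‖ ^ p) + ∫ x, wt (p * (γ - 1)) x * |u x| ^ p) := by
    rw [← integral_add (int_du hu hc _ p hp0) (int_u hu hc _ p hp0), ← integral_const_mul]
    refine integral_mono ?_ (((int_du hu hc _ p hp0).add (int_u hu hc _ p hp0)).const_mul _)
      fun x => ?_
    · refine Continuous.integrable_of_hasCompactSupport ?_ (cs_rpow (hvc.fderiv (𝕜 := ℝ)).norm hp0)
      exact (hvd.continuous_fderiv one_ne_zero).norm.rpow_const fun _ => Or.inr hp0.le
    · have hw := wt_pos γ x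
      have hw1 := wt_pos (γ - 1) x
      have hfd : ‖fderiv ℝ v x‖ ≤ wt γ x * ‖fderiv ℝ u x‖ + |γ| * (wt (γ - 1) x * |u x|) := by
        have : fderiv ℝ v x = wt γ x • fderiv ℝ u x + u x • fderiv ℝ (wt γ) x :=
          fderiv_mul ((wt_hasFDerivAt γ x).differentiableAt) (hu.differentiable one_ne_zero x)
        rw [this]
        refine (norm_add_le _ _).trans ?_
        rw [norm_smul, norm_smul, Real.norm_eq_abs, Real.norm_eq_abs, abs_of_pos hw]
        have := mul_le_mul_of_nonneg_left (wt_fderiv_norm γ x) (abs_nonneg (u x))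
        linarith
      calc ‖fderiv ℝ v x‖ ^ p
          ≤ (wt γ x * ‖fderiv ℝ u x‖ + |γ| * (wt (γ - 1) x * |u x|)) ^ p := by gcongr
        _ ≤ 2 ^ (p - 1) * ((wt γ x * ‖fderiv ℝ u x‖) ^ p + (|γ| * (wt (γ - 1) x * |u x|)) ^ p) :=
            by
            have := NNReal.rpow_add_le_mul_rpow_add_rpow
              ⟨wt γ x * ‖fderiv ℝ u x‖, by positivity⟩
              ⟨|γ| * (wt (γ - 1) x * |u x|), by positivity⟩ hp.le
            exact_mod_cast this
        _ = 2 ^ (p - 1) * (wt (γ * p) x * ‖fderiv ℝ u x‖ ^ p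
              + |γ| ^ p * (wt (p * (γ - 1)) x * |u x| ^ p)) := by
            rw [Real.mul_rpow hw.le (by positivity), Real.mul_rpow (by positivity) (by positivity),
              Real.mul_rpow hw1.le (by positivity), wt_rpow, wt_rpow, mul_comm (γ - 1) p]
        _ ≤ 2 ^ (p - 1) * ((1 + |γ| ^ p) * (wt (γ * p) x * ‖fderiv ℝ u x‖ ^ p
              + (wt (p * (γ - 1)) x * |u x| ^ p))) := by
            gcongr
            have h1 : 0 ≤ |γ| ^ p * (wt (γ * p) x * ‖fderiv ℝ u x‖ ^ p) :=
              mul_nonneg (by positivity) (mul_nonneg (wt_pos _ x).le (by positivity))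
            have h2 : 0 ≤ wt (p * (γ - 1)) x * |u x| ^ p :=
              (mul_nonneg (wt_pos _ x).le (by positivity))
            linarith
        _ = _ := by ring
  rw [e1]
  set I := ∫ x, ‖v x‖ ^ r with hI
  set J := ∫ x, ‖fderiv ℝ v x‖ ^ p with hJ
  have hI0 : 0 ≤ I := integral_nonneg fun x => by positivity
  have hJ0 : 0 ≤ J := integral_nonneg fun x => by positivity
  calc I = (I ^ r⁻¹) ^ r := by rw [Real.rpow_inv_rpow hI0 hr.ne']
    _ ≤ (S * J ^ p⁻¹) ^ r := by gcongr
    _ = ((S : ℝ) ^ p * J) ^ (r / p) := by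
      rw [Real.mul_rpow (by positivity) (by positivity), Real.mul_rpow (by positivity) (by positivity),
        ← Real.rpow_mul hJ0, ← Real.rpow_mul (by positivity)]
      congr 2 <;> field_simp
    _ ≤ _ := by
      rw [mul_assoc]
      gcongr

lemma holder_int (f g : EuclideanSpace ℝ (Fin N) → ℝ) (hf : Integrable f) (hg : Integrable g)
    (hf0 : ∀ x, 0 ≤ f x) (hg0 : ∀ x, 0 ≤ g x) (a b : ℝ) (ha : 0 ≤ a) (hb : 0 ≤ b)
    (hab : a + b = 1) :
    ∫ x, f x ^ a * g x ^ b ≤ (∫ x, f x) ^ a * (∫ x, g x) ^ b := by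
  have h := ENNReal.lintegral_mul_norm_pow_le (μ := volume)
    hf.aestronglyMeasurable.aemeasurable.ennreal_ofReal
    hg.aestronglyMeasurable.aemeasurable.ennreal_ofReal ha hb hab
  rw [← ofReal_integral_eq_lintegral_ofReal hf (Filter.Eventually.of_forall hf0),
    ← ofReal_integral_eq_lintegral_ofReal hg (Filter.Eventually.of_forall hg0),
    ENNReal.ofReal_rpow_of_nonneg (integral_nonneg hf0) ha,
    ENNReal.ofReal_rpow_of_nonneg (integral_nonneg hg0) hb,
    ← ENNReal.ofReal_mul (Real.rpow_nonneg (integral_nonneg hf0) _)] at h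
  have hnn : 0 ≤ (∫ x, f x) ^ a * (∫ x, g x) ^ b :=
    mul_nonneg (Real.rpow_nonneg (integral_nonneg hf0) _) (Real.rpow_nonneg (integral_nonneg hg0) _)
  rw [integral_eq_lintegral_of_nonneg_ae]
  · refine ENNReal.toReal_le_of_le_ofReal hnn (le_trans (le_of_eq ?_) h)
    refine lintegral_congr fun x => ?_
    rw [ENNReal.ofReal_mul (Real.rpow_nonneg (hf0 x) _), ENNReal.ofReal_rpow_of_nonneg (hf0 x) ha,
      ENNReal.ofReal_rpow_of_nonneg (hg0 x) hb]
  · exact Filter.Eventually.of_forall fun x =>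
      mul_nonneg (Real.rpow_nonneg (hf0 x) _) (Real.rpow_nonneg (hg0 x) _)
  · exact ((hf.aestronglyMeasurable.aemeasurable.pow_const a).mul
      (hg.aestronglyMeasurable.aemeasurable.pow_const b)).aestronglyMeasurable

end WSob

/-- Inhomogeneous weighted Sobolev inequality: under the compatibility conditions
`γ-1 ≤ β ≤ γ`, `1/p - 1/q = (1-γ+β)/N`, `N + p(γ-1) ≠ 0`, `p < N`, `q ≤ p*`,
and for any `ν ∈ ℝ`, there is `C > 0` such that every `u ∈ C_c^∞(ℝ^N)` satisfies
`‖ (1+|x|)^β u ‖_q ≤ C ‖ (1+|x|)^γ ∇u ‖_p + C ‖ (1+|x|)^{ν/p} u ‖_p`. -/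
theorem weighted_sobolev_inhomogeneous (N : ℕ) (hN : 2 ≤ N) (β γ ν : ℝ) (p q : ℝ)
    (hp : 1 < p) (hpq : p ≤ q) (hβγ₁ : γ - 1 ≤ β) (hβγ₂ : β ≤ γ)
    (hscal : 1 / p - 1 / q = (1 - γ + β) / (N : ℝ))
    (hne : (N : ℝ) + p * (γ - 1) ≠ 0) (hpN : p < N)
    (hq : q ≤ (N : ℝ) * p / ((N : ℝ) - p)) :
    ∃ C : ℝ, 0 < C ∧ ∀ u : EuclideanSpace ℝ (Fin N) → ℝ,
      ContDiff ℝ (⊤ : ℕ∞) u → HasCompactSupport u →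
      (∫ x : EuclideanSpace ℝ (Fin N), (1 + ‖x‖) ^ (q * β) * |u x| ^ q) ^ (1 / q) ≤
        C * (∫ x : EuclideanSpace ℝ (Fin N),
              (1 + ‖x‖) ^ (γ * p) * ‖fderiv ℝ u x‖ ^ p) ^ (1 / p) +
        C * (∫ x : EuclideanSpace ℝ (Fin N), (1 + ‖x‖) ^ ν * |u x| ^ p) ^ (1 / p) := by
  have hN0 : (0 : ℝ) < N := by positivity
  have hp0 : 0 < p := by linarith
  have hq0 : 0 < q := by linarith
  have hNp : 0 < (N : ℝ) - p := by linarith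
  set r : ℝ := (N : ℝ) * p / ((N : ℝ) - p) with hr
  have hr0 : 0 < r := by positivity
  have hri : r⁻¹ = p⁻¹ - (N : ℝ)⁻¹ := by rw [hr]; field_simp
  obtain ⟨Ch, hCh, hardy⟩ := WSob.hardy (N := N) γ ν p hp hne
  obtain ⟨Cs, hCs, sob⟩ := WSob.sobolev (N := N) γ p r hp (by omega) hr0 hri
  set K : ℝ := Cs * (1 + Ch) + Ch with hK
  have hK0 : 0 ≤ K := by positivity
  set a : ℝ := γ - β with ha
  set θ : ℝ := (1 - a) * q / r with hθ
  set θ' : ℝ := a * q / p with hθ'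
  have hθ0 : 0 ≤ θ := div_nonneg (mul_nonneg (by linarith) hq0.le) hr0.le
  have hθ'0 : 0 ≤ θ' := div_nonneg (mul_nonneg (by linarith) hq0.le) hp0.le
  have hrθ : r * θ = (1 - a) * q := by rw [hθ]; field_simp
  have hpθ : p * θ' = a * q := by rw [hθ']; field_simp
  have hsum : θ + θ' = 1 := by
    have h1 : θ + θ' = q * ((1 - a) * r⁻¹ + a * p⁻¹) := by
      rw [hθ, hθ']; field_simp
    have h2 : (1 - a) * r⁻¹ + a * p⁻¹ = 1 / q := by
      have h3 : (1 - γ + β) / (N : ℝ) = (1 - a) * (N : ℝ)⁻¹ := by rw [ha]; ring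
      rw [h3] at hscal
      rw [hri]
      have : 1 / p = p⁻¹ := one_div p
      linarith
    rw [h1, h2]; field_simp
  set M : ℝ := (2 ^ |q * β| : ℝ) ^ (1 / q) * K ^ (1 / p) *
    ((2 ^ |γ * p| : ℝ) ^ (1 / p) + (2 ^ |ν| : ℝ) ^ (1 / p)) with hM
  have hM0 : 0 ≤ M := by positivity
  refine ⟨M + 1, by positivity, fun u hu' hc => ?_⟩
  have hu : ContDiff ℝ 1 u := hu'.of_le (by exact_mod_cast le_top)
  set G := ∫ x, WSob.wt (γ * p) x * ‖fderiv ℝ u x‖ ^ p with hG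
  set B := ∫ x, WSob.wt ν x * |u x| ^ p with hB
  set A := ∫ x, WSob.wt (p * (γ - 1)) x * |u x| ^ p with hA
  set I := ∫ x, WSob.wt (γ * r) x * |u x| ^ r with hI
  have nn : ∀ t s : ℝ, ∀ x, 0 ≤ WSob.wt t x * |u x| ^ s := fun t s x =>
    mul_nonneg (WSob.wt_pos _ x).le (by positivity)
  have hG0 : 0 ≤ G := integral_nonneg fun x => mul_nonneg (WSob.wt_pos _ x).le (by positivity)
  have hB0 : 0 ≤ B := integral_nonneg (nn _ _)
  have hA0 : 0 ≤ A := integral_nonneg (nn _ _)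
  have hI0 : 0 ≤ I := integral_nonneg (nn _ _)
  have hA1 : A ≤ K * (G + B) := by
    refine (hardy u hu hc).trans ?_
    gcongr
    rw [hK]
    have : 0 ≤ Cs * (1 + Ch) := by positivity
    linarith
  have hI1 : I ≤ (K * (G + B)) ^ (r / p) := by
    refine (sob u hu hc).trans ?_
    refine Real.rpow_le_rpow (by positivity) ?_ (by positivity)
    have h1 : Cs * (G + A) ≤ Cs * (G + Ch * (G + B)) := by
      gcongr
      exact hardy u hu hc
    have h2 : 0 ≤ Cs * B := by positivity
    have h3 : 0 ≤ Ch * (G + B) := by positivity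
    rw [hK]
    linarith
  have hmain : ∫ x, WSob.wt (q * β) x * |u x| ^ q ≤ (K * (G + B)) ^ (q / p) := by
    have hh := WSob.holder_int _ _ (WSob.int_u hu hc (γ * r) r hr0)
      (WSob.int_u hu hc (p * (γ - 1)) p hp0) (nn _ _) (nn _ _) θ θ' hθ0 hθ'0 hsum
    have e1 : ∀ x, WSob.wt (q * β) x * |u x| ^ q = (WSob.wt (γ * r) x * |u x| ^ r) ^ θ *
        (WSob.wt (p * (γ - 1)) x * |u x| ^ p) ^ θ' := by
      intro x
      rw [Real.mul_rpow (WSob.wt_pos _ x).le (by positivity),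
        Real.mul_rpow (WSob.wt_pos _ x).le (by positivity), WSob.wt_rpow, WSob.wt_rpow,
        ← Real.rpow_mul (abs_nonneg _), ← Real.rpow_mul (abs_nonneg _), hrθ, hpθ,
        mul_mul_mul_comm, WSob.wt_mul,
        ← Real.rpow_add_of_nonneg (abs_nonneg _) (mul_nonneg (by linarith) hq0.le)
          (mul_nonneg (by linarith) hq0.le)]
      have h1 : γ * r * θ + p * (γ - 1) * θ' = q * β := by
        calc _ = γ * (r * θ) + (γ - 1) * (p * θ') := by ring
          _ = _ := by rw [hrθ, hpθ, ha]; ring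
      have h2 : (1 - a) * q + a * q = q := by ring
      rw [h1, h2]
    simp only [e1]
    refine hh.trans ?_
    calc I ^ θ * A ^ θ' ≤ ((K * (G + B)) ^ (r / p)) ^ θ * (K * (G + B)) ^ θ' := by gcongr
      _ = (K * (G + B)) ^ (q / p) := by
        rw [← Real.rpow_mul (by positivity), ← Real.rpow_add_of_nonneg (by positivity)
          (mul_nonneg (by positivity) hθ0) hθ'0]
        congr 1
        calc r / p * θ + θ' = (r * θ + p * θ') / p := by field_simp
          _ = q / p := by rw [hrθ, hpθ]; ring
  -- comparison with the original weights
  have hbase : ∀ x : EuclideanSpace ℝ (Fin N), 0 < 1 + ‖x‖ := fun x => by positivity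
  have cw : ∀ t : ℝ, Continuous (fun x : EuclideanSpace ℝ (Fin N) => (1 + ‖x‖) ^ t) := fun t =>
    (continuous_const.add continuous_norm).rpow_const fun x => Or.inl (hbase x).ne'
  have iu : ∀ t s : ℝ, 0 < s → Integrable
      (fun x : EuclideanSpace ℝ (Fin N) => (1 + ‖x‖) ^ t * |u x| ^ s) := by
    intro t s hs
    refine Continuous.integrable_of_hasCompactSupport ?_ (WSob.cs_rpow hc.norm hs).mul_left
    exact (cw t).mul (hu.continuous.abs.rpow_const fun _ => Or.inr hs.le)
  have idu : Integrable
      (fun x : EuclideanSpace ℝ (Fin N) => (1 + ‖x‖) ^ (γ * p) * ‖fderiv ℝ u x‖ ^ p) := by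
    refine Continuous.integrable_of_hasCompactSupport ?_
      (WSob.cs_rpow (hc.fderiv (𝕜 := ℝ)).norm hp0).mul_left
    exact (cw _).mul ((hu.continuous_fderiv one_ne_zero).norm.rpow_const fun _ => Or.inr hp0.le)
  set L := ∫ x : EuclideanSpace ℝ (Fin N), (1 + ‖x‖) ^ (q * β) * |u x| ^ q with hL
  set G1 := ∫ x : EuclideanSpace ℝ (Fin N), (1 + ‖x‖) ^ (γ * p) * ‖fderiv ℝ u x‖ ^ p with hG1
  set B1 := ∫ x : EuclideanSpace ℝ (Fin N), (1 + ‖x‖) ^ ν * |u x| ^ p with hB1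
  have hL0 : 0 ≤ L := integral_nonneg fun x => by positivity
  have hG10 : 0 ≤ G1 := integral_nonneg fun x => by positivity
  have hB10 : 0 ≤ B1 := integral_nonneg fun x => by positivity
  have hLle : L ≤ 2 ^ |q * β| * ∫ x, WSob.wt (q * β) x * |u x| ^ q := by
    rw [← integral_const_mul]
    refine integral_mono (iu _ _ hq0) ((WSob.int_u hu hc _ _ hq0).const_mul _) fun x => ?_
    simp only
    rw [← mul_assoc]
    gcongr
    exact WSob.le_wt _ x
  have hGle : G ≤ 2 ^ |γ * p| * G1 := by
    rw [hG1, ← integral_const_mul]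
    refine integral_mono (WSob.int_du hu hc _ _ hp0) (idu.const_mul _) fun x => ?_
    simp only
    rw [← mul_assoc]
    gcongr
    exact WSob.wt_le _ x
  have hBle : B ≤ 2 ^ |ν| * B1 := by
    rw [hB1, ← integral_const_mul]
    refine integral_mono (WSob.int_u hu hc _ _ hp0) ((iu _ _ hp0).const_mul _) fun x => ?_
    simp only
    rw [← mul_assoc]
    gcongr
    exact WSob.wt_le _ x
  have hp1 : 1 / p ≤ 1 := by rw [div_le_one hp0]; exact hp.le
  have hip : 0 ≤ 1 / p := by positivity
  have hGp : G ^ (1 / p) ≤ (2 ^ |γ * p| : ℝ) ^ (1 / p) * G1 ^ (1 / p) := by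
    rw [← Real.mul_rpow (by positivity) hG10]; gcongr
  have hBp : B ^ (1 / p) ≤ (2 ^ |ν| : ℝ) ^ (1 / p) * B1 ^ (1 / p) := by
    rw [← Real.mul_rpow (by positivity) hB10]; gcongr
  have hGB : (G + B) ^ (1 / p) ≤ G ^ (1 / p) + B ^ (1 / p) :=
    Real.rpow_add_le_add_rpow hG0 hB0 hip hp1
  have hx : 0 ≤ G1 ^ (1 / p) := by positivity
  have hy : 0 ≤ B1 ^ (1 / p) := by positivity
  calc L ^ (1 / q) ≤ (2 ^ |q * β| * (K * (G + B)) ^ (q / p)) ^ (1 / q) := by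
        refine Real.rpow_le_rpow hL0 (hLle.trans ?_) (by positivity)
        gcongr
    _ = (2 ^ |q * β| : ℝ) ^ (1 / q) * (K ^ (1 / p) * (G + B) ^ (1 / p)) := by
        rw [Real.mul_rpow (by positivity) (by positivity),
          ← Real.rpow_mul (x := K * (G + B)) (by positivity), ← Real.mul_rpow hK0 (by positivity)]
        congr 2
        field_simp
    _ ≤ (2 ^ |q * β| : ℝ) ^ (1 / q) * (K ^ (1 / p) *
          ((2 ^ |γ * p| : ℝ) ^ (1 / p) * G1 ^ (1 / p) + (2 ^ |ν| : ℝ) ^ (1 / p) * B1 ^ (1 / p))) := by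
        gcongr
        linarith
    _ ≤ (2 ^ |q * β| : ℝ) ^ (1 / q) * (K ^ (1 / p) *
          (((2 ^ |γ * p| : ℝ) ^ (1 / p) + (2 ^ |ν| : ℝ) ^ (1 / p)) *
            (G1 ^ (1 / p) + B1 ^ (1 / p)))) := by
        gcongr
        have h1 : 0 ≤ (2 ^ |γ * p| : ℝ) ^ (1 / p) * B1 ^ (1 / p) := by positivity
        have h2 : 0 ≤ (2 ^ |ν| : ℝ) ^ (1 / p) * G1 ^ (1 / p) := by positivity
        linarith
    _ = M * (G1 ^ (1 / p) + B1 ^ (1 / p)) := by rw [hM]; ring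
    _ ≤ (M + 1) * G1 ^ (1 / p) + (M + 1) * B1 ^ (1 / p) := by linarith
end

section
/- Let $N \ge 3$, $\alpha > 2$ and $\lambda < 0$. Let $m : \mathbb{R}^N \to \mathbb{R}$ be measurable with $0 < m_0 \le m(x) \le M$ for all $x$, and let $\phi : \mathbb{R}^N \to \mathbb{R}$ be a bounded continuous function with $\phi(x) > 0$ for all $x$, satisfying for every $x \in \mathbb{R}^N$ the integral representation $\phi(x) = \frac{1}{N(2-N)\omega_N} \int_{\mathbb{R}^N} \frac{\lambda\, \phi(y)}{m(y)\,|x-y|^{N-2}\,(1+|y|^{\alpha})}\, dy$, where $\omega_N$ is the volume of the unit ball in $\mathbb{R}^N$. Then there exists a constant $C > 0$ such that $\phi(x) \ge C\,(1+|x|)^{2-N}$ for every $x \in \mathbb{R}^N$. -/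
open MeasureTheory

/-- Lower bound for the (positive) first eigenfunction: if a bounded continuous
strictly positive `φ` satisfies the Newtonian-potential representation
`φ(x) = (N(2-N)ω_N)⁻¹ ∫ λ φ(y) / (m(y)|x-y|^{N-2}(1+|y|^α)) dy` with `λ < 0`,
then `φ(x) ≥ C (1+|x|)^{2-N}`. -/
theorem first_eigenfunction_lower_bound (N : ℕ) (hN : 3 ≤ N) (α : ℝ) (hα : 2 < α)
    (lam : ℝ) (hlam : lam < 0) (m₀ M : ℝ) (hm₀ : 0 < m₀)
    (m : EuclideanSpace ℝ (Fin N) → ℝ) (hm : Measurable m)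
    (hm₁ : ∀ x, m₀ ≤ m x) (hm₂ : ∀ x, m x ≤ M)
    (φ : EuclideanSpace ℝ (Fin N) → ℝ) (hφc : Continuous φ)
    (hφb : ∃ B : ℝ, ∀ x, φ x ≤ B) (hφpos : ∀ x, 0 < φ x)
    (hrep : ∀ x : EuclideanSpace ℝ (Fin N),
      φ x = (1 / ((N : ℝ) * (2 - (N : ℝ)) *
          (volume (Metric.ball (0 : EuclideanSpace ℝ (Fin N)) 1)).toReal)) *
        ∫ y : EuclideanSpace ℝ (Fin N),
          lam * φ y / (m y * ‖x - y‖ ^ ((N : ℝ) - 2) * (1 + ‖y‖ ^ α))) :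
    ∃ C : ℝ, 0 < C ∧ ∀ x : EuclideanSpace ℝ (Fin N),
      C * (1 + ‖x‖) ^ (2 - (N : ℝ)) ≤ φ x := by
  have hN' : (3 : ℝ) ≤ (N : ℝ) := by exact_mod_cast hN
  haveI : Nonempty (Fin N) := ⟨⟨0, by omega⟩⟩
  haveI : Nontrivial (EuclideanSpace ℝ (Fin N)) := inferInstance
  set w : ℝ := (volume (Metric.ball (0 : EuclideanSpace ℝ (Fin N)) 1)).toReal with hw
  have hwpos : 0 < w :=
    ENNReal.toReal_pos (Metric.measure_ball_pos volume 0 one_pos).ne' measure_ball_lt_top.ne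
  have hM : 0 < M := lt_of_lt_of_le hm₀ ((hm₁ 0).trans (hm₂ 0))
  set D : ℝ := (N : ℝ) * ((N : ℝ) - 2) * w with hD
  have hDpos : 0 < D := mul_pos (mul_pos (by linarith) (by linarith)) hwpos
  obtain ⟨z, -, hz⟩ := (isCompact_closedBall (0 : EuclideanSpace ℝ (Fin N)) 1).exists_isMinOn
    ⟨0, by simp⟩ hφc.continuousOn
  have hzp := hφpos z
  refine ⟨1 / D * ((-lam) * φ z / (M * 2)) * w, ?_, fun x => ?_⟩
  · have : 0 < -lam := by linarith
    positivity
  set G : EuclideanSpace ℝ (Fin N) → ℝ := fun y =>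
    (-lam) * φ y / (m y * ‖x - y‖ ^ ((N : ℝ) - 2) * (1 + ‖y‖ ^ α)) with hG
  have hnl : 0 < -lam := by linarith
  have hrepG : φ x = 1 / D * ∫ y, G y := by
    rw [hrep x]
    have h1 : (fun y => lam * φ y / (m y * ‖x - y‖ ^ ((N : ℝ) - 2) * (1 + ‖y‖ ^ α)))
        = fun y => - G y := by
      funext y; simp only [hG]; ring
    rw [h1, integral_neg]
    have h2 : (N : ℝ) * (2 - (N : ℝ)) * w = -D := by rw [hD]; ring
    rw [h2, one_div_neg_eq_neg_one_div]; ring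
  have hint : Integrable G := by
    by_contra h
    have := hφpos x
    rw [hrepG, integral_undef h] at this
    simp at this
  have hG0 : ∀ y, 0 ≤ G y := by
    intro y
    have := hφpos y
    have := hm₀.trans_le (hm₁ y)
    simp only [hG]
    positivity
  set c : ℝ := (-lam) * φ z / (M * 2) * (1 + ‖x‖) ^ (2 - (N : ℝ)) with hc
  have hae : ∀ᵐ y, y ≠ x := by
    rw [ae_iff]; simp
  have hlow : ∀ y ∈ Metric.ball (0 : EuclideanSpace ℝ (Fin N)) 1, y ≠ x → c ≤ G y := by
    intro y hy hyx
    have hy1 : ‖y‖ < 1 := by simpa using hy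
    have hmy := hm₀.trans_le (hm₁ y)
    have hxy : 0 < ‖x - y‖ := norm_pos_iff.2 (sub_ne_zero.2 hyx.symm)
    have hle : ‖x - y‖ ≤ 1 + ‖x‖ := by linarith [norm_sub_le x y]
    have hp : ‖x - y‖ ^ ((N : ℝ) - 2) ≤ (1 + ‖x‖) ^ ((N : ℝ) - 2) :=
      Real.rpow_le_rpow hxy.le hle (by linarith)
    have ha : ‖y‖ ^ α ≤ 1 := Real.rpow_le_one (norm_nonneg _) hy1.le (by linarith)
    have hzy : φ z ≤ φ y := hz (Metric.ball_subset_closedBall hy)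
    have hx0 : 0 < 1 + ‖x‖ := by positivity
    have hc' : c = (-lam) * φ z / (M * (1 + ‖x‖) ^ ((N : ℝ) - 2) * 2) := by
      rw [hc, show (2 - (N : ℝ)) = -((N : ℝ) - 2) by ring, Real.rpow_neg hx0.le]
      field_simp
    have hpos := Real.rpow_pos_of_pos hxy ((N : ℝ) - 2)
    rw [hc']
    simp only [hG]
    have hφy := hφpos y
    apply div_le_div₀
    · positivity
    · exact mul_le_mul_of_nonneg_left hzy hnl.le
    · positivity
    · apply mul_le_mul _ (by linarith) (by positivity) (by positivity)
      exact mul_le_mul (hm₂ y) hp hpos.le hM.le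
  have hkey : c * w ≤ ∫ y, G y := by
    calc c * w = ∫ y in Metric.ball (0 : EuclideanSpace ℝ (Fin N)) 1, c := by
          rw [setIntegral_const, smul_eq_mul, mul_comm]; rfl
      _ ≤ ∫ y in Metric.ball (0 : EuclideanSpace ℝ (Fin N)) 1, G y := by
          apply setIntegral_mono_on_ae _ hint.integrableOn measurableSet_ball
          · filter_upwards [hae] with y hy hyb using hlow y hyb hy
          · exact integrableOn_const measure_ball_lt_top.ne
      _ ≤ ∫ y, G y := setIntegral_le_integral hint (Filter.Eventually.of_forall hG0)
  rw [hrepG]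
  calc _ = 1 / D * (c * w) := by rw [hc]; ring
    _ ≤ _ := mul_le_mul_of_nonneg_left hkey (by positivity)
end

section
/- Let $N \ge 3$, $\alpha > 2$ and $\lambda \ne 0$. Let $m : \mathbb{R}^N \to \mathbb{R}$ be measurable with $0 < m_0 \le m(x) \le M$ for all $x$, and let $\phi : \mathbb{R}^N \to \mathbb{R}$ be a bounded measurable function, not identically zero, satisfying for every $x \in \mathbb{R}^N$ the integral representation $\phi(x) = \frac{1}{N(2-N)\omega_N} \int_{\mathbb{R}^N} \frac{\lambda\, \phi(y)}{m(y)\,|x-y|^{N-2}\,(1+|y|^{\alpha})}\, dy$, where $\omega_N$ is the volume of the unit ball in $\mathbb{R}^N$. Set $k = \left[\frac{N}{\alpha-2}\right] + 1$ (integer part). Then there exists a constant $C > 0$, depending only on $N$, $\alpha$ and $m_0$, such that $|\phi(x)| \le C\, |\lambda|^{k}\, \|\phi\|_{\infty}\, (1+|x|)^{2-N}$ for every $x \in \mathbb{R}^N$. -/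
open MeasureTheory

/-- Elementary: `(p+q)^s ≤ 2^s (p^s + q^s)` for nonnegative reals. -/
lemma aux_add_rpow {p q s : ℝ} (hp : 0 ≤ p) (hq : 0 ≤ q) (hs : 0 ≤ s) :
    (p + q) ^ s ≤ 2 ^ s * (p ^ s + q ^ s) := by
  have hps := Real.rpow_nonneg hp s
  have hqs := Real.rpow_nonneg hq s
  have h2 : (0 : ℝ) ≤ 2 ^ s := by positivity
  rcases le_total p q with h | h
  · calc (p + q) ^ s ≤ (2 * q) ^ s := Real.rpow_le_rpow (by positivity) (by linarith) hs
      _ = 2 ^ s * q ^ s := Real.mul_rpow (by norm_num) hq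
      _ ≤ _ := mul_le_mul_of_nonneg_left (by linarith) h2
  · calc (p + q) ^ s ≤ (2 * p) ^ s := Real.rpow_le_rpow (by positivity) (by linarith) hs
      _ = 2 ^ s * p ^ s := Real.mul_rpow (by norm_num) hp
      _ ≤ _ := mul_le_mul_of_nonneg_left (by linarith) h2

/-- Elementary: `u^{-a} v^{-b} ≤ u^{-(a+b)} + v^{-(a+b)}`. -/
lemma aux_young {u v a b : ℝ} (hu : 0 < u) (hv : 0 < v) (ha : 0 ≤ a) (hb : 0 ≤ b) :
    u ^ (-a) * v ^ (-b) ≤ u ^ (-(a + b)) + v ^ (-(a + b)) := by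
  have h1 : 0 < u ^ (-(a + b)) := by positivity
  have h2 : 0 < v ^ (-(a + b)) := by positivity
  rcases le_total u v with h | h
  · have : v ^ (-b) ≤ u ^ (-b) := Real.rpow_le_rpow_of_nonpos hu h (by linarith)
    calc u ^ (-a) * v ^ (-b) ≤ u ^ (-a) * u ^ (-b) := by gcongr
      _ = u ^ (-(a + b)) := by rw [← Real.rpow_add hu]; ring_nf
      _ ≤ _ := by linarith
  · have : u ^ (-a) ≤ v ^ (-a) := Real.rpow_le_rpow_of_nonpos hv h (by linarith)
    calc u ^ (-a) * v ^ (-b) ≤ v ^ (-a) * v ^ (-b) := by gcongr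
      _ = v ^ (-(a + b)) := by rw [← Real.rpow_add hv]; ring_nf
      _ ≤ _ := by linarith

/-- Uniform bound for `∫ |x-y|^{-a} (1+|y|)^{-b} dy`. -/
lemma aux_kernel (N : ℕ) (hN : 1 ≤ N) (a b : ℝ) (ha : 0 ≤ a) (haN : a < N) (hb : 0 ≤ b)
    (hab : (N : ℝ) < a + b) :
    ∃ K : ℝ, 0 ≤ K ∧ ∀ x : EuclideanSpace ℝ (Fin N),
      Integrable (fun y : EuclideanSpace ℝ (Fin N) => ‖x - y‖ ^ (-a) * (1 + ‖y‖) ^ (-b)) ∧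
      ∫ y : EuclideanSpace ℝ (Fin N), ‖x - y‖ ^ (-a) * (1 + ‖y‖) ^ (-b) ≤ K := by
  set H : EuclideanSpace ℝ (Fin N) → ℝ := fun y => 2 ^ a * (1 + ‖y‖) ^ (-(a + b)) with hH
  set I : EuclideanSpace ℝ (Fin N) → ℝ :=
    (Metric.ball 0 1).indicator (fun z => ‖z‖ ^ (-a)) with hI
  have hHi : Integrable H := (integrable_one_add_norm (by simpa using hab)).const_mul _
  have hIi : Integrable I := by
    rw [hI, integrable_indicator_iff Metric.isOpen_ball.measurableSet]
    refine integrableOn_ball_of_norm_le_rpow (C := 1) (α := a) (by simpa using hN)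
      (by simpa using haN) (Filter.Eventually.of_forall fun z => ?_)
      (Measurable.aestronglyMeasurable (by fun_prop))
    rw [Real.norm_of_nonneg (by positivity), one_mul]
  have hI0 : ∀ z, 0 ≤ I z := fun z => Set.indicator_nonneg (fun _ _ => by positivity) z
  have hH0 : ∀ z, 0 ≤ H z := fun z => by simp only [hH]; positivity
  set G : EuclideanSpace ℝ (Fin N) → ℝ := fun z => I z + H z with hG
  have hGi : Integrable G := hIi.add hHi
  have hpt : ∀ x y : EuclideanSpace ℝ (Fin N),
      ‖x - y‖ ^ (-a) * (1 + ‖y‖) ^ (-b) ≤ G (x - y) + H y := by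
    intro x y
    rcases lt_or_ge ‖x - y‖ 1 with h | h
    · have h1 : I (x - y) = ‖x - y‖ ^ (-a) := by
        rw [hI, Set.indicator_of_mem (by simpa using h)]
      have h2 : (1 + ‖y‖) ^ (-b) ≤ 1 :=
        Real.rpow_le_one_of_one_le_of_nonpos (by linarith [norm_nonneg y]) (by linarith)
      have h3 : ‖x - y‖ ^ (-a) * (1 + ‖y‖) ^ (-b) ≤ ‖x - y‖ ^ (-a) :=
        mul_le_of_le_one_right (by positivity) h2
      have := hH0 y
      have := hH0 (x - y)
      simp only [hG]
      linarith
    · have h1 : ‖x - y‖ ^ (-a) ≤ 2 ^ a * (1 + ‖x - y‖) ^ (-a) := by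
        have e : ((1 + ‖x - y‖) / 2) ^ (-a) = 2 ^ a * (1 + ‖x - y‖) ^ (-a) := by
          rw [Real.div_rpow (by positivity) (by norm_num), Real.rpow_neg (by norm_num : (0:ℝ) ≤ 2),
            div_inv_eq_mul, mul_comm]
        rw [← e]
        exact Real.rpow_le_rpow_of_nonpos (by positivity) (by linarith) (by linarith)
      have h2 := aux_young (u := 1 + ‖x - y‖) (v := 1 + ‖y‖) (by positivity) (by positivity) ha hb
      calc ‖x - y‖ ^ (-a) * (1 + ‖y‖) ^ (-b)
          ≤ 2 ^ a * (1 + ‖x - y‖) ^ (-a) * (1 + ‖y‖) ^ (-b) := by gcongr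
        _ = 2 ^ a * ((1 + ‖x - y‖) ^ (-a) * (1 + ‖y‖) ^ (-b)) := by ring
        _ ≤ 2 ^ a * ((1 + ‖x - y‖) ^ (-(a + b)) + (1 + ‖y‖) ^ (-(a + b))) := by gcongr
        _ = H (x - y) + H y := by simp only [hH]; ring
        _ ≤ _ := by have := hI0 (x - y); simp only [hG]; linarith
  refine ⟨(∫ z, G z) + ∫ z, H z, ?_, fun x => ?_⟩
  · exact add_nonneg (integral_nonneg fun z => add_nonneg (hI0 z) (hH0 z)) (integral_nonneg hH0)
  · have hGx : Integrable (fun y => G (x - y)) := hGi.comp_sub_left x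
    have hs : Integrable (fun y => G (x - y) + H y) := hGx.add hHi
    have hint : Integrable (fun y : EuclideanSpace ℝ (Fin N) =>
        ‖x - y‖ ^ (-a) * (1 + ‖y‖) ^ (-b)) := by
      refine hs.mono' (Measurable.aestronglyMeasurable (by fun_prop))
        (Filter.Eventually.of_forall fun y => ?_)
      rw [Real.norm_of_nonneg (by positivity)]
      exact hpt x y
    refine ⟨hint, (integral_mono hint hs (hpt x)).trans_eq ?_⟩
    rw [integral_add hGx hHi, integral_sub_left_eq_self G volume x]

/-- Decay of the Newtonian potential of `(1+|y|)^{-γ}`. -/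
lemma aux_potential (N : ℕ) (hN : 3 ≤ N) (g s : ℝ) (hs : 0 ≤ s) (hsN : s ≤ (N : ℝ) - 2)
    (hg : s + 2 < g) :
    ∃ K : ℝ, 0 ≤ K ∧ ∀ x : EuclideanSpace ℝ (Fin N),
      ∃ F : EuclideanSpace ℝ (Fin N) → ℝ, Integrable F ∧
        (∀ y, 0 ≤ F y) ∧
        (∀ y, y ≠ x → ‖x - y‖ ^ (-((N : ℝ) - 2)) * (1 + ‖y‖) ^ (-g) ≤ F y) ∧
        ∫ y, F y ≤ K * (1 + ‖x‖) ^ (-s) := by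
  have hN' : (3 : ℝ) ≤ N := by exact_mod_cast hN
  obtain ⟨K1, hK1, h1⟩ := aux_kernel N (by omega) ((N : ℝ) - 2) (g - s) (by linarith)
    (by linarith) (by linarith) (by linarith)
  obtain ⟨K2, hK2, h2⟩ := aux_kernel N (by omega) ((N : ℝ) - 2 - s) g (by linarith)
    (by linarith) (by linarith) (by linarith)
  refine ⟨2 ^ s * (K1 + K2), by positivity, fun x => ?_⟩
  obtain ⟨i1, b1⟩ := h1 x
  obtain ⟨i2, b2⟩ := h2 x
  refine ⟨fun y => (1 + ‖x‖) ^ (-s) * 2 ^ s *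
    (‖x - y‖ ^ (-((N : ℝ) - 2)) * (1 + ‖y‖) ^ (-(g - s)) +
      ‖x - y‖ ^ (-((N : ℝ) - 2 - s)) * (1 + ‖y‖) ^ (-g)),
    (i1.add i2).const_mul _, fun y => by positivity, fun y hy => ?_, ?_⟩
  · have hr : 0 < ‖x - y‖ := norm_pos_iff.2 (sub_ne_zero.2 hy.symm)
    have hy1 : 0 < 1 + ‖y‖ := by positivity
    have hx1 : 0 < 1 + ‖x‖ := by positivity
    have t : (1 + ‖x‖) ^ s ≤ 2 ^ s * ((1 + ‖y‖) ^ s + ‖x - y‖ ^ s) := by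
      refine le_trans (Real.rpow_le_rpow hx1.le ?_ hs) (aux_add_rpow hy1.le hr.le hs)
      have := norm_add_le (x - y) y
      rw [sub_add_cancel] at this
      linarith
    have e1 : (1 + ‖y‖) ^ (-(g - s)) = (1 + ‖y‖) ^ s * (1 + ‖y‖) ^ (-g) := by
      rw [← Real.rpow_add hy1]; ring_nf
    have e2 : ‖x - y‖ ^ (-((N : ℝ) - 2 - s)) = ‖x - y‖ ^ s * ‖x - y‖ ^ (-((N : ℝ) - 2)) := by
      rw [← Real.rpow_add hr]; ring_nf
    have e3 : (1 + ‖x‖) ^ (-s) * (1 + ‖x‖) ^ s = 1 := by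
      rw [← Real.rpow_add hx1]; simp
    beta_reduce
    rw [e1, e2]
    calc ‖x - y‖ ^ (-((N : ℝ) - 2)) * (1 + ‖y‖) ^ (-g)
        = (1 + ‖x‖) ^ (-s) * (1 + ‖x‖) ^ s *
          (‖x - y‖ ^ (-((N : ℝ) - 2)) * (1 + ‖y‖) ^ (-g)) := by rw [e3, one_mul]
      _ ≤ (1 + ‖x‖) ^ (-s) * (2 ^ s * ((1 + ‖y‖) ^ s + ‖x - y‖ ^ s)) *
          (‖x - y‖ ^ (-((N : ℝ) - 2)) * (1 + ‖y‖) ^ (-g)) := by gcongr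
      _ = _ := by ring
  · rw [integral_const_mul, integral_add i1 i2]
    calc _ ≤ (1 + ‖x‖) ^ (-s) * 2 ^ s * (K1 + K2) := by gcongr
      _ = _ := by ring

/-- One bootstrap step. -/
lemma aux_step (N : ℕ) (hN : 3 ≤ N) (α : ℝ) (hα : 2 < α) (m₀ : ℝ) (hm₀ : 0 < m₀)
    (c β s : ℝ) (hs : 0 ≤ s) (hsN : s ≤ (N : ℝ) - 2) (hβ : s + 2 < α + β) :
    ∃ K : ℝ, 0 ≤ K ∧ ∀ (lam A : ℝ) (m φ : EuclideanSpace ℝ (Fin N) → ℝ), 0 ≤ A →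
      (∀ x, m₀ ≤ m x) →
      (∀ x : EuclideanSpace ℝ (Fin N), φ x = c *
        ∫ y : EuclideanSpace ℝ (Fin N),
          lam * φ y / (m y * ‖x - y‖ ^ ((N : ℝ) - 2) * (1 + ‖y‖ ^ α))) →
      (∀ x, |φ x| ≤ A * (1 + ‖x‖) ^ (-β)) →
      ∀ x, |φ x| ≤ K * |lam| * A * (1 + ‖x‖) ^ (-s) := by
  have hN' : (3 : ℝ) ≤ N := by exact_mod_cast hN
  obtain ⟨K, hK, h⟩ := aux_potential N hN (α + β) s hs hsN hβ
  refine ⟨|c| * (2 ^ α / m₀) * K, by positivity, fun lam A m φ hA hm hrep hφ x => ?_⟩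
  obtain ⟨F, hF, hF0, hFy, hFi⟩ := h x
  have hb : ‖∫ y : EuclideanSpace ℝ (Fin N),
      lam * φ y / (m y * ‖x - y‖ ^ ((N : ℝ) - 2) * (1 + ‖y‖ ^ α))‖
      ≤ ∫ y, (|lam| * A * (2 ^ α / m₀)) * F y := by
    refine norm_integral_le_of_norm_le (hF.const_mul _) (Filter.Eventually.of_forall fun y => ?_)
    rcases eq_or_ne y x with rfl | hy
    · have : (N : ℝ) - 2 ≠ 0 := by linarith
      have h0 := hF0 y
      simp only [sub_self, norm_zero, Real.zero_rpow this, mul_zero, zero_mul, div_zero]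
      positivity
    · have hr : 0 < ‖x - y‖ := norm_pos_iff.2 (sub_ne_zero.2 hy.symm)
      have hy1 : 0 < 1 + ‖y‖ := by positivity
      have hmy : 0 < m y := hm₀.trans_le (hm y)
      have hw : (1 + ‖y‖ ^ α)⁻¹ ≤ 2 ^ α * (1 + ‖y‖) ^ (-α) := by
        have := aux_add_rpow (p := 1) (q := ‖y‖) (s := α) (by norm_num) (norm_nonneg y)
          (by linarith)
        rw [Real.one_rpow] at this
        rw [Real.rpow_neg hy1.le, ← div_eq_mul_inv, inv_eq_one_div,
          div_le_div_iff₀ (by positivity) (by positivity)]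
        linarith
      have hminv : (m y)⁻¹ ≤ m₀⁻¹ := inv_anti₀ hm₀ (hm y)
      rw [norm_div, norm_mul, Real.norm_eq_abs, Real.norm_eq_abs,
        Real.norm_of_nonneg (by positivity), div_eq_mul_inv, mul_inv, mul_inv,
        ← Real.rpow_neg hr.le]
      calc |lam| * |φ y| * ((m y)⁻¹ * ‖x - y‖ ^ (-((N : ℝ) - 2)) * (1 + ‖y‖ ^ α)⁻¹)
          ≤ |lam| * (A * (1 + ‖y‖) ^ (-β)) *
            (m₀⁻¹ * ‖x - y‖ ^ (-((N : ℝ) - 2)) * (2 ^ α * (1 + ‖y‖) ^ (-α))) := by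
            gcongr
            exact hφ y
        _ = |lam| * A * (2 ^ α / m₀) *
            (‖x - y‖ ^ (-((N : ℝ) - 2)) * ((1 + ‖y‖) ^ (-α) * (1 + ‖y‖) ^ (-β))) := by
            rw [div_eq_mul_inv]; ring
        _ = |lam| * A * (2 ^ α / m₀) *
            (‖x - y‖ ^ (-((N : ℝ) - 2)) * (1 + ‖y‖) ^ (-(α + β))) := by
            rw [← Real.rpow_add hy1, neg_add]
        _ ≤ _ := by
            gcongr
            exact hFy y hy
  rw [integral_const_mul] at hb
  rw [hrep x, abs_mul]
  calc _ ≤ |c| * (|lam| * A * (2 ^ α / m₀) * (K * (1 + ‖x‖) ^ (-s))) := by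
        gcongr
        exact hb.trans (by gcongr)
    _ = _ := by ring

/-- Upper bound for eigenfunctions: if a bounded `φ ≢ 0` satisfies the
Newtonian-potential representation
`φ(x) = (N(2-N)ω_N)⁻¹ ∫ λ φ(y) / (m(y)|x-y|^{N-2}(1+|y|^α)) dy` with `λ ≠ 0`,
then `|φ(x)| ≤ C |λ|^k ‖φ‖_∞ (1+|x|)^{2-N}` where `k = [N/(α-2)] + 1` and `C`
depends only on `N`, `α` and `m₀`. -/
theorem eigenfunction_upper_bound (N : ℕ) (hN : 3 ≤ N) (α : ℝ) (hα : 2 < α)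
    (m₀ : ℝ) (hm₀ : 0 < m₀) :
    ∃ C : ℝ, 0 < C ∧
      ∀ (lam M : ℝ) (m φ : EuclideanSpace ℝ (Fin N) → ℝ),
        lam ≠ 0 → Measurable m → (∀ x, m₀ ≤ m x) → (∀ x, m x ≤ M) →
        Measurable φ → (∃ B : ℝ, ∀ x, |φ x| ≤ B) → (∃ x, φ x ≠ 0) →
        (∀ x : EuclideanSpace ℝ (Fin N),
          φ x = (1 / ((N : ℝ) * (2 - (N : ℝ)) *
              (volume (Metric.ball (0 : EuclideanSpace ℝ (Fin N)) 1)).toReal)) *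
            ∫ y : EuclideanSpace ℝ (Fin N),
              lam * φ y / (m y * ‖x - y‖ ^ ((N : ℝ) - 2) * (1 + ‖y‖ ^ α))) →
        ∀ x : EuclideanSpace ℝ (Fin N),
          |φ x| ≤ C * |lam| ^ (⌊(N : ℝ) / (α - 2)⌋₊ + 1) * (⨆ y, |φ y|) *
            (1 + ‖x‖) ^ (2 - (N : ℝ)) := by
  have hN' : (3 : ℝ) ≤ N := by exact_mod_cast hN
  set k : ℕ := ⌊(N : ℝ) / (α - 2)⌋₊ + 1 with hk
  have hα2 : 0 < α - 2 := by linarith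
  have hkpos : (0 : ℝ) < k := by rw [hk]; positivity
  have hkN : (N : ℝ) < k * (α - 2) := by
    have := Nat.lt_floor_add_one ((N : ℝ) / (α - 2))
    rw [div_lt_iff₀ hα2] at this
    rw [hk]; push_cast; exact this
  set δ : ℝ := ((N : ℝ) - 2) / k with hδ
  have hδ0 : 0 ≤ δ := div_nonneg (by linarith) hkpos.le
  have hδα : δ < α - 2 := by
    rw [hδ, div_lt_iff₀ hkpos]; linarith
  have hkδ : (k : ℝ) * δ = N - 2 := by rw [hδ]; field_simp
  set c : ℝ := 1 / ((N : ℝ) * (2 - (N : ℝ)) *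
    (volume (Metric.ball (0 : EuclideanSpace ℝ (Fin N)) 1)).toReal) with hc
  have key : ∀ j : ℕ, j ≤ k → ∃ C : ℝ, 0 ≤ C ∧
      ∀ (lam S : ℝ) (m φ : EuclideanSpace ℝ (Fin N) → ℝ), 0 ≤ S → (∀ x, m₀ ≤ m x) →
        (∀ x : EuclideanSpace ℝ (Fin N), φ x = c *
          ∫ y : EuclideanSpace ℝ (Fin N),
            lam * φ y / (m y * ‖x - y‖ ^ ((N : ℝ) - 2) * (1 + ‖y‖ ^ α))) →
        (∀ x, |φ x| ≤ S) →
        ∀ x, |φ x| ≤ C * |lam| ^ j * S * (1 + ‖x‖) ^ (-((j : ℝ) * δ)) := by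
    intro j
    induction j with
    | zero =>
      intro _
      refine ⟨1, by norm_num, fun lam S m φ hS hm hrep hφ x => ?_⟩
      simpa using hφ x
    | succ j ih =>
      intro hj
      obtain ⟨C, hC, h⟩ := ih (by omega)
      have hjk : ((j + 1 : ℕ) : ℝ) ≤ k := by exact_mod_cast hj
      obtain ⟨K, hK, hstep⟩ := aux_step N hN α hα m₀ hm₀ c ((j : ℝ) * δ) (((j + 1 : ℕ) : ℝ) * δ)
        (by positivity) (by rw [← hkδ]; exact mul_le_mul_of_nonneg_right hjk hδ0)
        (by push_cast; linarith)
      refine ⟨K * C, by positivity, fun lam S m φ hS hm hrep hφ x => ?_⟩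
      refine (hstep lam (C * |lam| ^ j * S) m φ (by positivity) hm hrep
        (h lam S m φ hS hm hrep hφ) x).trans_eq ?_
      ring
  obtain ⟨C, hC, h⟩ := key k le_rfl
  refine ⟨C + 1, by positivity, fun lam M m φ _ _ hm _ _ hB _ hrep x => ?_⟩
  obtain ⟨B, hB⟩ := hB
  have hbdd : BddAbove (Set.range fun y => |φ y|) := ⟨B, by rintro _ ⟨y, rfl⟩; exact hB y⟩
  have hle : ∀ y, |φ y| ≤ ⨆ y, |φ y| := fun y => le_ciSup hbdd y
  have hS : 0 ≤ ⨆ y, |φ y| := (abs_nonneg _).trans (hle 0)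
  have := h lam _ m φ hS hm hrep hle x
  rw [hkδ, neg_sub] at this
  refine this.trans ?_
  gcongr
  linarith
end
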